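/- Let k be a field and let I_{3,6} be the Plücker ideal in the polynomial ring k[p_{ijk} : 1 ≤ i < j < k ≤ 6] in 20 variables. Define w ∈ ℝ^{C(6,3)} by w_{123} = w_{124} = w_{134} = w_{234} = 1, w_{125} = w_{126} = w_{156} = w_{256} = w_{345} = w_{346} = w_{356} = w_{456} = 2, and w_T = 0 for the remaining eight triples T. Then the initial ideal in_w(I_{3,6}) is NOT a prime ideal; precisely, in_w(I_{3,6}) = P ∩ Q, where P = in_w(I_{3,6}) + ⟨ p_{125}p_{346} − p_{126}p_{345} ⟩ and Q = in_w(I_{3,6}) + ⟨ p_{135}, p_{136}, p_{145}, p_{146}, p_{235}, p_{236}, p_{245}, p_{246} ⟩ are two distinct prime ideals. -/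

import Mathlib

open scoped Classical

open MvPolynomial

/-- The `w`-weight of an exponent vector `a`, namely `∑ aᵢ wᵢ`. -/
noncomputable def expWeight {σ : Type*} (w : σ → ℝ) (a : σ →₀ ℕ) : ℝ :=
  a.sum fun i e => (e : ℝ) * w i

/-- The initial form of `f` with respect to the weight vector `w`: the sum of the terms of `f`
of minimal `w`-weight. -/
noncomputable def initForm {σ : Type*} {k : Type*} [CommRing k] (w : σ → ℝ)
    (f : MvPolynomial σ k) : MvPolynomial σ k :=
  ∑ a ∈ f.support.filter (fun a => ∀ b ∈ f.support, expWeight w a ≤ expWeight w b),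
    monomial a (f.coeff a)

/-- The initial ideal `in_w(I) = ⟨in_w(f) : f ∈ I⟩`. -/
noncomputable def initIdeal {σ : Type*} {k : Type*} [CommRing k] (w : σ → ℝ)
    (I : Ideal (MvPolynomial σ k)) : Ideal (MvPolynomial σ k) :=
  Ideal.span { g | ∃ f ∈ I, g = initForm w f }

/-- A monomial: a nonzero scalar multiple of a product of variables. -/
def IsMonomial {σ : Type*} {k : Type*} [CommRing k] (g : MvPolynomial σ k) : Prop :=
  ∃ (a : σ →₀ ℕ) (c : k), c ≠ 0 ∧ g = monomial a c

/-- An ideal is monomial-free if it contains no monomial. -/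
def MonomialFree {σ : Type*} {k : Type*} [CommRing k] (I : Ideal (MvPolynomial σ k)) : Prop :=
  ∀ g ∈ I, ¬ IsMonomial g

/-- The Plücker (algebra) map, sending the variable `p_S` (for a `d`-subset `S` of `{0,…,n-1}`)
to the `d × d` minor on the columns indexed by `S` of a `d × n` matrix of indeterminates. -/
noncomputable def pluckerMap (k : Type*) [CommRing k] (d n : ℕ) :
    MvPolynomial {s : Finset (Fin n) // s.card = d} k →ₐ[k] MvPolynomial (Fin d × Fin n) k :=
  aeval fun S =>
    (Matrix.of fun r c : Fin d => (X (r, ((S.1.orderIsoOfFin S.2 c : S.1) : Fin n)) :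
       MvPolynomial (Fin d × Fin n) k)).det

/-- The Plücker ideal `I_{d,n}`: the ideal of algebraic relations among the maximal
minors of a generic `d × n` matrix. -/
noncomputable def pluckerIdeal (k : Type*) [CommRing k] (d n : ℕ) :
    Ideal (MvPolynomial {s : Finset (Fin n) // s.card = d} k) :=
  RingHom.ker (pluckerMap k d n)

/-- The variable index `p_{ijk}` for a `3`-element subset `{i,j,k}` of `{0,…,5}`
(representing `{1,…,6}`). -/
def tri (i j l : Fin 6) (h : ({i, j, l} : Finset (Fin 6)).card = 3) :
    {s : Finset (Fin 6) // s.card = 3} := ⟨{i, j, l}, h⟩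

/-- The weight vector `w = f_{1256} + f_{3456} + g_{123456} + g_{125634}` in the relative
interior of an FFGG cone: `w_{123} = w_{124} = w_{134} = w_{234} = 1`,
`w_{125} = w_{126} = w_{156} = w_{256} = w_{345} = w_{346} = w_{356} = w_{456} = 2`, and
`w_T = 0` for the remaining eight triples (indices shifted to `{0,…,5}`). -/
noncomputable def w36 (S : {s : Finset (Fin 6) // s.card = 3}) : ℝ :=
  if S.1 ∈ ({{0, 1, 2}, {0, 1, 3}, {0, 2, 3}, {1, 2, 3}} : Finset (Finset (Fin 6))) then 1
  else if S.1 ∈ ({{0, 1, 4}, {0, 1, 5}, {0, 4, 5}, {1, 4, 5},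
      {2, 3, 4}, {2, 3, 5}, {2, 4, 5}, {3, 4, 5}} : Finset (Finset (Fin 6))) then 2
  else 0

/-- The ideal `P = in_w(I_{3,6}) + ⟨ p_{125}p_{346} − p_{126}p_{345} ⟩`. -/
noncomputable def Pideal (k : Type*) [Field k] :
    Ideal (MvPolynomial {s : Finset (Fin 6) // s.card = 3} k) :=
  initIdeal w36 (pluckerIdeal k 3 6) ⊔
    Ideal.span {X (tri 0 1 4 (by decide)) * X (tri 2 3 5 (by decide))
      - X (tri 0 1 5 (by decide)) * X (tri 2 3 4 (by decide))}

/-- The ideal `Q = in_w(I_{3,6}) + ⟨ p_{135}, p_{136}, p_{145}, p_{146},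
p_{235}, p_{236}, p_{245}, p_{246} ⟩`. -/
noncomputable def Qideal (k : Type*) [Field k] :
    Ideal (MvPolynomial {s : Finset (Fin 6) // s.card = 3} k) :=
  initIdeal w36 (pluckerIdeal k 3 6) ⊔
    Ideal.span {X (tri 0 2 4 (by decide)), X (tri 0 2 5 (by decide)),
      X (tri 0 3 4 (by decide)), X (tri 0 3 5 (by decide)),
      X (tri 1 2 4 (by decide)), X (tri 1 2 5 (by decide)),
      X (tri 1 3 4 (by decide)), X (tri 1 3 5 (by decide))}

abbrev Tr := {s : Finset (Fin 6) // s.card = 3}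

def idx (i j l : Fin 6) : Tr :=
  if h : ({i, j, l} : Finset (Fin 6)).card = 3 then ⟨{i, j, l}, h⟩ else ⟨{0, 1, 2}, by decide⟩

def wN (S : Tr) : ℕ :=
  if S.1 ∈ ({{0, 1, 2}, {0, 1, 3}, {0, 2, 3}, {1, 2, 3}} : Finset (Finset (Fin 6))) then 1
  else if S.1 ∈ ({{0, 1, 4}, {0, 1, 5}, {0, 4, 5}, {1, 4, 5},
      {2, 3, 4}, {2, 3, 5}, {2, 4, 5}, {3, 4, 5}} : Finset (Finset (Fin 6))) then 2
  else 0

theorem w36_eq (S : Tr) : w36 S = (wN S : ℝ) := by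
  unfold w36 wN
  split_ifs <;> simp

def sgl (i j : Fin 6) : ℤ := if i < j then 1 else if j < i then -1 else 0
def sg (i j l : Fin 6) : ℤ := sgl i j * sgl i l * sgl j l

def pt (i : Fin 3) (b : Bool) : Fin 6 :=
  match i, b with
  | 0, false => 0 | 0, true => 1 | 1, false => 2 | 1, true => 3 | 2, false => 4 | 2, true => 5

def swp (i : Fin 3) (T : Tr) : Tr :=
  ⟨T.1.map (Equiv.swap (pt i false) (pt i true)).toEmbedding, by rw [Finset.card_map, T.2]⟩

def eP (i : Fin 3) (b : Bool) (T : Tr) : ℕ := if pt i b ∈ T.1 ∧ pt i (!b) ∉ T.1 then 1 else 0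

def okOut (i : Fin 3) (b c : Fin 6) : Bool :=
  decide (b < c) && decide (b ≠ pt i false) && decide (b ≠ pt i true) &&
    decide (c ≠ pt i false) && decide (c ≠ pt i true)

def okE (i : Fin 3) (b c e f : Fin 6) : Bool :=
  okOut i b c && okOut i e f && !(decide (i = 2) &&
    ((decide (b = 0) && decide (c = 1) && decide (e = 2) && decide (f = 3)) ||
     (decide (b = 2) && decide (c = 3) && decide (e = 0) && decide (f = 1))))

def okq (i : Fin 3) (b c e f : Fin 6) : Bool :=
  okE i b c e f && !(decide (b = 4) && decide (c = 5) &&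
    ((decide (i = 0) && decide (e = 2) && decide (f = 3)) ||
     (decide (i = 1) && decide (e = 0) && decide (f = 1))))

theorem okE_or : ∀ (i : Fin 3) (b c e f : Fin 6), okE i b c e f = true →
    okq i b c e f = true ∨ okq i e f b c = true := by
  decide +kernel

theorem exch_sg : ∀ (i : Fin 3) (b c : Fin 6), okOut i b c = true →
    sg (pt i false) b c = sg (pt i true) b c ∧ sg (pt i true) b c * sg (pt i true) b c = 1 := by
  decide +kernel

theorem exch_wt : ∀ (i : Fin 3) (b c e f : Fin 6), okq i b c e f = true →
    wN (idx (pt i true) b c) + wN (idx (pt i false) e f) =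
      wN (idx (pt i false) b c) + wN (idx (pt i true) e f) := by
  decide +kernel

theorem exch_wt1 : ∀ (i : Fin 3) (b c e f : Fin 6), okq i b c e f = true →
    (sg e b c * sg (pt i true) (pt i false) f = 0 ∨
      wN (idx (pt i false) b c) + wN (idx (pt i true) e f) <
      wN (idx e b c) + wN (idx (pt i true) (pt i false) f)) := by
  decide +kernel

theorem exch_wt2 : ∀ (i : Fin 3) (b c e f : Fin 6), okq i b c e f = true →
    (sg f b c * sg (pt i true) e (pt i false) = 0 ∨
      wN (idx (pt i false) b c) + wN (idx (pt i true) e f) <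
      wN (idx f b c) + wN (idx (pt i true) e (pt i false))) := by
  decide +kernel

theorem eP_ex : ∀ (i : Fin 3) (t : Bool) (T : Tr), eP i t T = 1 → ∃ b c : Fin 6,
    okOut i b c = true ∧ T = idx (pt i t) b c ∧ swp i T = idx (pt i (!t)) b c := by
  decide +kernel

section Init

variable {σ k : Type*} [Field k]

theorem expWeight_eq (w : σ → ℝ) (n : σ → ℕ) (hw : ∀ T, w T = n T) (a : σ →₀ ℕ) :
    expWeight w a = (Finsupp.weight n a : ℝ) := by
  unfold expWeight
  rw [Finsupp.weight_apply]
  simp [Finsupp.sum, hw]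

theorem coeff_initForm (w : σ → ℝ) (f : MvPolynomial σ k) (a : σ →₀ ℕ) :
    coeff a (initForm w f) = if a ∈ f.support ∧ ∀ b ∈ f.support, expWeight w a ≤ expWeight w b
      then coeff a f else 0 := by
  unfold initForm
  rw [coeff_sum]
  simp only [coeff_monomial, Finset.sum_ite_eq', Finset.mem_filter]

theorem mem_initIdeal (w : σ → ℝ) (n : σ → ℕ) (hw : ∀ T, w T = n T)
    (I : Ideal (MvPolynomial σ k)) (g h1 h2 : MvPolynomial σ k) (m m1 m2 : ℕ)
    (hg : IsWeightedHomogeneous n g m) (hh1 : IsWeightedHomogeneous n h1 m1)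
    (hh2 : IsWeightedHomogeneous n h2 m2) (hm1 : m < m1) (hm2 : m < m2)
    (hI : g + h1 + h2 ∈ I) : g ∈ initIdeal w I := by
  by_cases h0 : g = 0
  · rw [h0]; exact Ideal.zero_mem _
  apply Ideal.subset_span
  refine ⟨_, hI, ?_⟩
  obtain ⟨a0, ha0⟩ := ne_zero_iff.1 h0
  have c1 : ∀ a, Finsupp.weight n a ≤ m → coeff a h1 = 0 := by
    intro a ha
    by_contra hc
    have := hh1 hc
    omega
  have c2 : ∀ a, Finsupp.weight n a ≤ m → coeff a h2 = 0 := by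
    intro a ha
    by_contra hc
    have := hh2 hc
    omega
  have cg : ∀ a, coeff a g ≠ 0 → Finsupp.weight n a = m := fun a ha => hg ha
  have hlow : ∀ b, b ∈ (g + h1 + h2).support → m ≤ Finsupp.weight n b := by
    intro b hb
    by_contra hc
    rw [mem_support_iff, coeff_add, coeff_add, c1 b (by omega), c2 b (by omega)] at hb
    have := cg b (by simpa using hb)
    omega
  have hin : ∀ a, coeff a g ≠ 0 → coeff a (g + h1 + h2) = coeff a g := by
    intro a ha
    rw [coeff_add, coeff_add, c1 a (cg a ha).le, c2 a (cg a ha).le, add_zero, add_zero]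
  ext a
  rw [coeff_initForm]
  simp only [expWeight_eq w n hw, Nat.cast_le]
  by_cases ha : coeff a g = 0
  · rw [if_neg, ha]
    rintro ⟨h3, h4⟩
    have h5 := h4 a0 (by rw [mem_support_iff, hin a0 ha0]; exact ha0)
    rw [cg a0 ha0] at h5
    rw [mem_support_iff, coeff_add, coeff_add, c1 a h5, c2 a h5, ha] at h3
    simp at h3
  · rw [if_pos, hin a ha]
    refine ⟨by rw [mem_support_iff, hin a ha]; exact ha, fun b hb => ?_⟩
    rw [cg a ha]
    exact hlow b hb

theorem aeval_initForm (w : σ → ℝ) (n : σ → ℕ) (hw : ∀ T, w T = n T) {A : Type*} [CommRing A]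
    [Algebra k A] (q : σ → Polynomial A) (v : σ → A)
    (h : ∀ T, ∃ g : Polynomial A, q T = Polynomial.X ^ (n T) * g ∧ g.coeff 0 = v T)
    (f : MvPolynomial σ k) (hf : aeval q f = 0) : aeval v (initForm w f) = 0 := by
  choose g hg hgv using h
  by_cases h0 : f = 0
  · subst h0
    have : initForm w (0 : MvPolynomial σ k) = 0 := by simp [initForm]
    rw [this, map_zero]
  obtain ⟨a0, ha0, hmin⟩ := Finset.exists_min_image f.support (fun a => Finsupp.weight n a)
    (by rwa [Finset.nonempty_iff_ne_empty, ne_eq, support_eq_empty])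
  have hmon : ∀ a : σ →₀ ℕ, (a.prod fun T e => q T ^ e) =
      Polynomial.X ^ (Finsupp.weight n a) * (a.prod fun T e => g T ^ e) := by
    intro a
    rw [Finsupp.weight_apply, Finsupp.sum, ← Finset.prod_pow_eq_pow_sum, Finsupp.prod,
      Finsupp.prod, ← Finset.prod_mul_distrib]
    refine Finset.prod_congr rfl fun T _ => ?_
    rw [hg, mul_pow, ← pow_mul, smul_eq_mul, mul_comm (n T)]
  have hc0 : ∀ a : σ →₀ ℕ, (a.prod fun T e => g T ^ e).coeff 0 = a.prod fun T e => v T ^ e := by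
    intro a
    rw [Polynomial.coeff_zero_eq_eval_zero, Finsupp.prod, Polynomial.eval_prod, Finsupp.prod]
    refine Finset.prod_congr rfl fun T _ => ?_
    rw [Polynomial.eval_pow, ← Polynomial.coeff_zero_eq_eval_zero, hgv]
  have h1 := congrArg (fun p => Polynomial.coeff p (Finsupp.weight n a0)) hf
  simp only [aeval_def, eval₂_eq] at h1
  rw [Polynomial.finsetSum_coeff, Polynomial.coeff_zero] at h1
  have hfil : f.support.filter (fun a => ∀ b ∈ f.support, expWeight w a ≤ expWeight w b) =
      f.support.filter (fun a => Finsupp.weight n a = Finsupp.weight n a0) := by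
    ext a
    simp only [Finset.mem_filter, expWeight_eq w n hw, Nat.cast_le]
    refine and_congr_right fun ha => ⟨fun hh => le_antisymm (hh a0 ha0) (hmin a ha), fun hh b hb => ?_⟩
    rw [hh]; exact hmin b hb
  rw [initForm, hfil, map_sum, Finset.sum_filter]
  refine Eq.trans ?_ h1
  refine Finset.sum_congr rfl fun a ha => ?_
  have h2 := hmon a
  rw [Finsupp.prod] at h2
  rw [h2]
  have e1 : (algebraMap k (Polynomial A)) (coeff a f) = Polynomial.C (algebraMap k A (coeff a f)) := rfl
  rw [e1, Polynomial.coeff_C_mul, Polynomial.coeff_X_pow_mul']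
  split_ifs with h3 h4 h4
  · rw [h3, Nat.sub_self, hc0, aeval_monomial]
  · omega
  · have := hmin a ha; exact absurd (le_antisymm h4 this) h3
  · simp

end Init

section Pl

set_option linter.unusedSimpArgs false

variable (k : Type) [Field k]

noncomputable def DD (i j l : Fin 6) : MvPolynomial (Fin 3 × Fin 6) k :=
  X (0, i) * X (1, j) * X (2, l) - X (0, i) * X (1, l) * X (2, j)
  - X (0, j) * X (1, i) * X (2, l) + X (0, j) * X (1, l) * X (2, i)
  + X (0, l) * X (1, i) * X (2, j) - X (0, l) * X (1, j) * X (2, i)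

theorem orderIso_idx (i j l : Fin 6) (h : ({i, j, l} : Finset (Fin 6)).card = 3)
    (hij : i < j) (hjl : j < l) (c : Fin 3) :
    ((({i, j, l} : Finset (Fin 6)).orderIsoOfFin h c : ({i, j, l} : Finset (Fin 6))) : Fin 6)
      = ![i, j, l] c := by
  have := Finset.orderEmbOfFin_unique h (f := ![i, j, l]) (by
    intro x; fin_cases x <;> simp) (by
    intro x y hxy
    fin_cases x <;> fin_cases y <;> simp at hxy ⊢ <;> first | assumption | exact hij.trans hjl)
  rw [this]; rfl

theorem pl_lt (i j l : Fin 6) (hij : i < j) (hjl : j < l) :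
    pluckerMap k 3 6 (X (idx i j l)) = DD k i j l := by
  have h : ({i, j, l} : Finset (Fin 6)).card = 3 := by
    rw [Finset.card_eq_three]
    exact ⟨i, j, l, hij.ne, (hij.trans hjl).ne, hjl.ne, rfl⟩
  rw [idx, dif_pos h, pluckerMap, aeval_X, Matrix.det_fin_three]
  simp only [Matrix.of_apply, orderIso_idx i j l h hij hjl, DD]
  simp

noncomputable def qq (i j l : Fin 6) : MvPolynomial Tr k := C (sg i j l : k) * X (idx i j l)

theorem idx_a (i j l : Fin 6) : idx i j l = idx j i l := by
  unfold idx; simp only [Finset.insert_comm]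
theorem idx_b (i j l : Fin 6) : idx i j l = idx i l j := by
  unfold idx; simp only [Finset.pair_comm]

theorem pl_qq (i j l : Fin 6) : pluckerMap k 3 6 (qq k i j l) = DD k i j l := by
  unfold qq
  rw [map_mul, algHom_C]
  rcases lt_trichotomy i j with h | h | h
  · rcases lt_trichotomy j l with h' | h' | h'
    · have := h.trans h'
      rw [pl_lt k i j l h h']; simp [sg, sgl, *]
    · subst h'; simp [sg, sgl, DD]
    · rcases lt_trichotomy i l with h'' | h'' | h''
      · rw [idx_b, pl_lt k i l j h'' h']
        simp [sg, sgl, h, h', h'', h.not_gt, h'.not_gt, h''.not_gt, DD] <;> ring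
      · subst h''; simp [sg, sgl, DD] <;> ring
      · rw [idx_b, idx_a, pl_lt k l i j h'' h]
        simp [sg, sgl, h, h', h'', h.not_gt, h'.not_gt, h''.not_gt, DD] <;> ring
  · subst h; simp [sg, sgl, DD] <;> ring
  · rcases lt_trichotomy i l with h' | h' | h'
    · have := h.trans h'
      rw [idx_a, pl_lt k j i l h h']
      simp [sg, sgl, h, h', this, h.not_gt, h'.not_gt, this.not_gt, DD] <;> ring
    · subst h'; simp [sg, sgl, DD] <;> ring
    · rcases lt_trichotomy j l with h'' | h'' | h''
      · rw [idx_a, idx_b, pl_lt k j l i h'' h']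
        simp [sg, sgl, h, h', h'', h.not_gt, h'.not_gt, h''.not_gt, DD] <;> ring
      · subst h''; simp [sg, sgl, DD]
      · rw [idx_a, idx_b, idx_a, pl_lt k l j i h'' h]
        simp [sg, sgl, h, h', h'', h.not_gt, h'.not_gt, h''.not_gt, DD] <;> ring

theorem exch_mem (a b c d e f : Fin 6) :
    qq k a b c * qq k d e f - qq k d b c * qq k a e f
      + (-(qq k e b c * qq k d a f)) + (-(qq k f b c * qq k d e a)) ∈ pluckerIdeal k 3 6 := by
  rw [pluckerIdeal, RingHom.mem_ker]
  change pluckerMap k 3 6 _ = 0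
  simp only [map_add, map_sub, map_mul, map_neg, pl_qq]
  simp only [DD]
  ring

theorem wh_C_XX (c : k) (S T : Tr) :
    IsWeightedHomogeneous wN (C c * (X S * X T) : MvPolynomial Tr k) (wN S + wN T) := by
  have := (isWeightedHomogeneous_C (R := k) wN c).mul
    ((isWeightedHomogeneous_X k wN S).mul (isWeightedHomogeneous_X k wN T))
  simpa using this

theorem wh_qq (a b c d e f : Fin 6) (m : ℕ)
    (h : sg a b c * sg d e f = 0 ∨ m < wN (idx a b c) + wN (idx d e f)) :
    ∃ m1, m < m1 ∧ IsWeightedHomogeneous wN (-(qq k a b c * qq k d e f)) m1 := by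
  have he : -(qq k a b c * qq k d e f) =
      C (-((sg a b c * sg d e f : ℤ) : k)) * (X (idx a b c) * X (idx d e f)) := by
    simp [qq]; ring
  rw [he]
  rcases h with h | h
  · refine ⟨m + 1, by omega, ?_⟩
    rw [h]
    simpa using isWeightedHomogeneous_zero k wN (m + 1)
  · exact ⟨_, h, wh_C_XX k _ _ _⟩

noncomputable abbrev JJ : Ideal (MvPolynomial Tr k) := initIdeal w36 (pluckerIdeal k 3 6)

theorem jrel0 (i : Fin 3) (b c e f : Fin 6) (h : okq i b c e f = true) :
    (X (idx (pt i false) b c) * X (idx (pt i true) e f) -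
      X (idx (pt i true) b c) * X (idx (pt i false) e f) : MvPolynomial Tr k) ∈ JJ k := by
  have hb : okOut i b c = true := by simp [okq, okE] at h; tauto
  have he : okOut i e f = true := by simp [okq, okE] at h; tauto
  obtain ⟨s1, s2⟩ := exch_sg i b c hb
  obtain ⟨s3, s4⟩ := exch_sg i e f he
  have h1 := exch_wt i b c e f h
  obtain ⟨m1, hm1, w1⟩ := wh_qq k _ _ _ _ _ _ _ (exch_wt1 i b c e f h)
  obtain ⟨m2, hm2, w2⟩ := wh_qq k _ _ _ _ _ _ _ (exch_wt2 i b c e f h)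
  have hg : IsWeightedHomogeneous wN (qq k (pt i false) b c * qq k (pt i true) e f -
      qq k (pt i true) b c * qq k (pt i false) e f)
      (wN (idx (pt i false) b c) + wN (idx (pt i true) e f)) := by
    have hx := wh_C_XX k ((sg (pt i true) b c * sg (pt i true) e f : ℤ) : k)
      (idx (pt i false) b c) (idx (pt i true) e f)
    have hy := wh_C_XX k (-((sg (pt i true) b c * sg (pt i true) e f : ℤ) : k))
      (idx (pt i true) b c) (idx (pt i false) e f)
    rw [h1] at hy
    convert hx.add hy using 1
    simp only [qq, s1, s3, Int.cast_mul, C_mul, C_neg]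
    ring
  have hmem := mem_initIdeal w36 wN w36_eq _ _ _ _ _ _ _ hg w1 w2 hm1 hm2
    (exch_mem k (pt i false) b c (pt i true) e f)
  have hfin := Ideal.mul_mem_left _ (C ((sg (pt i true) b c * sg (pt i true) e f : ℤ) : k)) hmem
  convert hfin using 1
  have u1 : C (sg (pt i true) b c : k) * C (sg (pt i true) b c : k) = (1 : MvPolynomial Tr k) := by
    rw [← C_mul, ← Int.cast_mul, s2]; simp
  have u2 : C (sg (pt i true) e f : k) * C (sg (pt i true) e f : k) = (1 : MvPolynomial Tr k) := by
    rw [← C_mul, ← Int.cast_mul, s4]; simp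
  simp only [qq, s1, s3, Int.cast_mul, C_mul]
  generalize (C (sg (pt i true) b c : k) : MvPolynomial Tr k) = c1 at *
  generalize (C (sg (pt i true) e f : k) : MvPolynomial Tr k) = c2 at *
  linear_combination (-(X (idx (pt i false) b c) * X (idx (pt i true) e f) -
      X (idx (pt i true) b c) * X (idx (pt i false) e f))) * (u1 * (c2 * c2) + u2)

theorem jrel (i : Fin 3) (b c e f : Fin 6) (h : okE i b c e f = true) :
    (X (idx (pt i false) b c) * X (idx (pt i true) e f) -
      X (idx (pt i true) b c) * X (idx (pt i false) e f) : MvPolynomial Tr k) ∈ JJ k := by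
  rcases okE_or i b c e f h with h | h
  · exact jrel0 k i b c e f h
  · have := (JJ k).neg_mem (jrel0 k i e f b c h)
    convert this using 1
    ring

end Pl

section Fibre

variable {σ L B : Type*}

noncomputable def dvec (e : Fin 3 → Bool → σ → ℕ) (τ : σ → L) (T : σ) :
    ((Fin 3 × Bool) ⊕ L) →₀ ℕ :=
  Finsupp.single (Sum.inr (τ T)) 1 + ∑ p : Fin 3 × Bool, Finsupp.single (Sum.inl p) (e p.1 p.2 T)

theorem dvec_inl (e : Fin 3 → Bool → σ → ℕ) (τ : σ → L) (T : σ) (i : Fin 3) (b : Bool) :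
    dvec e τ T (Sum.inl (i, b)) = e i b T := by
  simp [dvec, Finsupp.single_apply]

theorem dvec_inr (e : Fin 3 → Bool → σ → ℕ) (τ : σ → L) (T : σ) (o : L) :
    dvec e τ T (Sum.inr o) = if τ T = o then 1 else 0 := by
  simp [dvec, Finsupp.single_apply]

/-- Combinatorial data for exchanging coordinates of variables. -/
structure FlipData (e : Fin 3 → Bool → σ → ℕ) (τ : σ → L) (fl : Fin 3 → σ → σ) : Prop where
  tot_le : ∀ i T, e i true T + e i false T ≤ 1
  tot_eq : ∀ i T T', τ T = τ T' →
    e i true T + e i false T = e i true T' + e i false T'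
  fl_same : ∀ i b T, e i b (fl i T) = e i (!b) T
  fl_other : ∀ i j b T, i ≠ j → e j b (fl i T) = e j b T
  fl_typ : ∀ i T, τ (fl i T) = τ T
  inj : ∀ T T', τ T = τ T' → (∀ i b, e i b T = e i b T') → T = T'

variable {e : Fin 3 → Bool → σ → ℕ} {τ : σ → L} {fl : Fin 3 → σ → σ}

theorem FlipData.dvec_add (H : FlipData e τ fl) (i : Fin 3) (b : Bool) (T T' : σ)
    (h : e i b T = 1) (h' : e i (!b) T' = 1) :
    dvec e τ (fl i T) + dvec e τ (fl i T') = dvec e τ T + dvec e τ T' := by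
  ext q
  rcases q with ⟨j, c⟩ | o
  · simp only [Finsupp.add_apply, dvec_inl]
    by_cases hij : i = j
    · subst hij
      rw [H.fl_same, H.fl_same]
      have h1 := H.tot_le i T
      have h2 := H.tot_le i T'
      cases b <;> cases c <;> simp at * <;> omega
    · rw [H.fl_other i j c T hij, H.fl_other i j c T' hij]
  · simp only [Finsupp.add_apply, dvec_inr, H.fl_typ]

theorem sum_map_apply {ν : Type*} (d : σ → (ν →₀ ℕ)) (s : Multiset σ) (q : ν) :
    (s.map d).sum q = (s.map (fun T => d T q)).sum := by
  induction s using Multiset.induction_on with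
  | empty => simp
  | cons a s ih => simp [ih]

theorem exists_pos (g : σ → ℕ) (s : Multiset σ) (h : 0 < (s.map g).sum) : ∃ T ∈ s, 0 < g T := by
  by_contra hc
  push Not at hc
  have : (s.map g).sum = 0 := by
    apply Multiset.sum_eq_zero
    intro x hx
    obtain ⟨T, hT, rfl⟩ := Multiset.mem_map.1 hx
    have := hc T hT
    omega
  omega

variable [CommMonoid B] {y : σ → B}

theorem FlipData.step (H : FlipData e τ fl)
    (hy : ∀ i T T', e i false T = 1 → e i true T' = 1 → y T * y T' = y (fl i T) * y (fl i T'))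
    (i : Fin 3) (T T1 : σ) (r s : Multiset σ) (hτ : τ T1 = τ T)
    (hs : ((T1 ::ₘ r).map (dvec e τ)).sum = ((T ::ₘ s).map (dvec e τ)).sum) :
    ∃ T2 r', τ T2 = τ T ∧ (∀ b, e i b T2 = e i b T) ∧ (∀ j b, i ≠ j → e j b T2 = e j b T1) ∧
      ((T2 ::ₘ r').map (dvec e τ)).sum = ((T ::ₘ s).map (dvec e τ)).sum ∧
      ((T2 ::ₘ r').map y).prod = ((T1 ::ₘ r).map y).prod := by
  by_cases hb : ∀ b, e i b T1 = e i b T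
  · exact ⟨T1, r, hτ, hb, fun _ _ _ => rfl, hs, rfl⟩
  have ht := H.tot_eq i T1 T hτ
  have hl := H.tot_le i T
  have hl1 := H.tot_le i T1
  have key : ∃ b, e i b T = 1 ∧ e i b T1 = 0 ∧ e i (!b) T1 = 1 ∧ e i (!b) T = 0 := by
    push Not at hb
    obtain ⟨b, hb⟩ := hb
    by_cases hc : e i b T1 = 0
    · refine ⟨b, ?_⟩
      cases b <;> simp at * <;> omega
    · refine ⟨!b, ?_⟩
      cases b <;> simp at * <;> omega
  obtain ⟨b, k1, k2, k3, k4⟩ := key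
  have hq := DFunLike.congr_fun hs (Sum.inl (i, b))
  rw [sum_map_apply, sum_map_apply] at hq
  simp only [dvec_inl, Multiset.map_cons, Multiset.sum_cons] at hq
  obtain ⟨T'', hT'', hp⟩ := exists_pos (fun x => e i b x) r (by omega)
  have k5 : e i b T'' = 1 := by
    have := H.tot_le i T''
    cases b <;> omega
  obtain ⟨r', rfl⟩ := Multiset.exists_cons_of_mem hT''
  refine ⟨fl i T1, fl i T'' ::ₘ r', ?_, ?_, ?_, ?_, ?_⟩
  · rw [H.fl_typ, hτ]
  · intro c
    rw [H.fl_same]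
    cases b <;> cases c <;> simp at * <;> omega
  · intro j c hij
    rw [H.fl_other i j c T1 hij]
  · rw [← hs]
    simp only [Multiset.map_cons, Multiset.sum_cons, ← add_assoc]
    rw [H.dvec_add i (!b) T1 T'' k3 (by simpa using k5)]
  · simp only [Multiset.map_cons, Multiset.prod_cons, ← mul_assoc]
    congr 1
    cases b
    · rw [mul_comm, ← hy i T'' T1 k5 k3, mul_comm]
    · rw [hy i T1 T'' k3 k5]

theorem FlipData.fibre (H : FlipData e τ fl)
    (hy : ∀ i T T', e i false T = 1 → e i true T' = 1 → y T * y T' = y (fl i T) * y (fl i T'))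
    (s t : Multiset σ) (hs : (t.map (dvec e τ)).sum = (s.map (dvec e τ)).sum) :
    (t.map y).prod = (s.map y).prod := by
  induction s using Multiset.induction_on generalizing t with
  | empty =>
    rcases Multiset.empty_or_exists_mem t with rfl | ⟨T, hT⟩
    · rfl
    · exfalso
      obtain ⟨r, rfl⟩ := Multiset.exists_cons_of_mem hT
      have := DFunLike.congr_fun hs (Sum.inr (τ T))
      simp [dvec_inr] at this
  | cons T s ih =>
    have h0 := DFunLike.congr_fun hs (Sum.inr (τ T))
    simp only [sum_map_apply] at h0
    obtain ⟨T0, hT0, hp⟩ := exists_pos (fun S => dvec e τ S (Sum.inr (τ T))) t (by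
      rw [h0]; simp [dvec_inr])
    have hτ0 : τ T0 = τ T := by
      by_contra hc
      simp [dvec_inr, hc] at hp
    obtain ⟨r0, rfl⟩ := Multiset.exists_cons_of_mem hT0
    obtain ⟨T1, r1, hτ1, a1, b1, hs1, hy1⟩ := H.step hy 0 T T0 r0 s hτ0 hs
    obtain ⟨T2, r2, hτ2, a2, b2, hs2, hy2⟩ := H.step hy 1 T T1 r1 s hτ1 hs1
    obtain ⟨T3, r3, hτ3, a3, b3, hs3, hy3⟩ := H.step hy 2 T T2 r2 s hτ2 hs2
    have hT : T3 = T := by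
      apply H.inj _ _ hτ3
      intro i b
      fin_cases i
      · exact ((b3 0 b (by decide)).trans (b2 0 b (by decide))).trans (a1 b)
      · exact (b3 1 b (by decide)).trans (a2 b)
      · exact a3 b
    subst hT
    rw [← hy1, ← hy2, ← hy3]
    simp only [Multiset.map_cons, Multiset.sum_cons, Multiset.prod_cons, add_right_inj] at hs3 ⊢
    rw [ih r3 hs3]

/-- The toric map. -/
noncomputable def toricMap (k : Type*) [Field k] (e : Fin 3 → Bool → σ → ℕ) (τ : σ → L) :
    MvPolynomial σ k →ₐ[k] MvPolynomial ((Fin 3 × Bool) ⊕ L) k :=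
  aeval fun T => monomial (dvec e τ T) 1

theorem prod_map_monomial {ν k : Type*} [Field k] (d : σ → (ν →₀ ℕ)) (s : Multiset σ) :
    (s.map (fun T => (monomial (d T) (1 : k)))).prod = monomial ((s.map d).sum) 1 := by
  induction s using Multiset.induction_on with
  | empty => simp
  | cons a s ih => simp [ih, monomial_mul]

theorem monomial_eq_multiset {k : Type*} [Field k] (a : σ →₀ ℕ) :
    (monomial a (1 : k)) = ((Finsupp.toMultiset a).map X).prod := by
  rw [Finsupp.toMultiset_map, Finsupp.prod_toMultiset, monomial_eq, C_1, one_mul,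
    Finsupp.prod_mapDomain_index] <;> simp [pow_add]

theorem FlipData.ker_le {k : Type*} [Field k] (H : FlipData e τ fl) (I : Ideal (MvPolynomial σ k))
    (hI : ∀ i T T', e i false T = 1 → e i true T' = 1 →
      (X T * X T' - X (fl i T) * X (fl i T') : MvPolynomial σ k) ∈ I)
    (f : MvPolynomial σ k) (hf : toricMap k e τ f = 0) : f ∈ I := by
  have hφ : ∀ a, toricMap k e τ (monomial a 1) =
      monomial (((Finsupp.toMultiset a).map (dvec e τ)).sum) 1 := by
    intro a
    rw [monomial_eq_multiset, map_multiset_prod, Multiset.map_map, ← prod_map_monomial]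
    congr 2
    ext1 T
    simp [toricMap]
  have hm : ∀ a, Ideal.Quotient.mk I (monomial a 1) =
      ((Finsupp.toMultiset a).map (fun T => Ideal.Quotient.mk I (X T))).prod := by
    intro a
    rw [monomial_eq_multiset, map_multiset_prod, Multiset.map_map]
    rfl
  have hfib := fun s t => H.fibre (y := fun T => Ideal.Quotient.mk I (X T : MvPolynomial σ k))
    (fun i T T' h h' => by
      rw [← map_mul, ← map_mul]; exact Ideal.Quotient.eq.2 (hI i T T' h h')) s t
  let sec : MvPolynomial ((Fin 3 × Bool) ⊕ L) k →ₗ[k] (MvPolynomial σ k ⧸ I) :=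
    (basisMonomials _ k).constr k (fun n =>
      if h : ∃ a : σ →₀ ℕ, ((Finsupp.toMultiset a).map (dvec e τ)).sum = n then
        Ideal.Quotient.mk I (monomial h.choose 1) else 0)
  have hsec : ∀ n, sec (monomial n 1) = if h : ∃ a : σ →₀ ℕ,
      ((Finsupp.toMultiset a).map (dvec e τ)).sum = n then
        Ideal.Quotient.mk I (monomial h.choose 1) else 0 := by
    intro n
    have := (basisMonomials ((Fin 3 × Bool) ⊕ L) k).constr_basis k (fun n =>
      if h : ∃ a : σ →₀ ℕ, ((Finsupp.toMultiset a).map (dvec e τ)).sum = n then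
        Ideal.Quotient.mk I (monomial h.choose 1) else 0) n
    rwa [coe_basisMonomials] at this
  have main : sec ∘ₗ (toricMap k e τ).toLinearMap = (Ideal.Quotient.mkₐ k I).toLinearMap := by
    apply (basisMonomials σ k).ext
    intro a
    simp only [coe_basisMonomials, LinearMap.comp_apply, AlgHom.toLinearMap_apply, hφ, hsec]
    have hex : ∃ a' : σ →₀ ℕ, ((Finsupp.toMultiset a').map (dvec e τ)).sum =
      ((Finsupp.toMultiset a).map (dvec e τ)).sum := ⟨a, rfl⟩
    rw [dif_pos hex]
    show _ = Ideal.Quotient.mk I (monomial a 1)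
    rw [hm, hm]
    exact hfib _ _ hex.choose_spec
  have := LinearMap.congr_fun main f
  simp only [LinearMap.comp_apply, AlgHom.toLinearMap_apply, hf, map_zero] at this
  exact Ideal.Quotient.eq_zero_iff_mem.1 this.symm

end Fibre

section Lift

variable (k : Type) [Field k]

theorem tr_cases : ∀ T : Tr, T = idx 0 1 2 ∨ T = idx 0 1 3 ∨ T = idx 0 1 4 ∨ T = idx 0 1 5 ∨
    T = idx 0 2 3 ∨ T = idx 0 2 4 ∨ T = idx 0 2 5 ∨ T = idx 0 3 4 ∨ T = idx 0 3 5 ∨ T = idx 0 4 5 ∨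
    T = idx 1 2 3 ∨ T = idx 1 2 4 ∨ T = idx 1 2 5 ∨ T = idx 1 3 4 ∨ T = idx 1 3 5 ∨ T = idx 1 4 5 ∨
    T = idx 2 3 4 ∨ T = idx 2 3 5 ∨ T = idx 2 4 5 ∨ T = idx 3 4 5 := by
  decide +kernel

theorem lift_main {A : Type} [Field A] [Algebra k A] (M : Fin 3 → Fin 6 → Polynomial A)
    (v : Tr → A)
    (h : ∀ T, ∃ g : Polynomial A, aeval (fun p : Fin 3 × Fin 6 => M p.1 p.2)
      (pluckerMap k 3 6 (X T)) = Polynomial.X ^ (wN T) * g ∧ g.coeff 0 = v T)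
    (f : MvPolynomial Tr k) (hf : f ∈ JJ k) : aeval v f = 0 := by
  have : JJ k ≤ RingHom.ker (aeval v : MvPolynomial Tr k →ₐ[k] A) := by
    apply Ideal.span_le.2
    rintro _ ⟨g, hg, rfl⟩
    rw [SetLike.mem_coe, RingHom.mem_ker]
    refine aeval_initForm w36 wN w36_eq _ v h g ?_
    have hg' : pluckerMap k 3 6 g = 0 := hg
    have e : aeval (fun T => aeval (fun p : Fin 3 × Fin 6 => M p.1 p.2)
        (pluckerMap k 3 6 (X T))) = (aeval (R := k) (fun p : Fin 3 × Fin 6 => M p.1 p.2)).comp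
          (pluckerMap k 3 6) := by
      apply MvPolynomial.algHom_ext
      intro T
      simp
    rw [e, AlgHom.comp_apply, hg', map_zero]
  exact this hf

theorem lift_T {A : Type} [Field A] [Algebra k A] {M : Fin 3 → Fin 6 → Polynomial A}
    {v : Tr → A} (i j l : Fin 6) (hij : i < j) (hjl : j < l) (n : ℕ) (hn : wN (idx i j l) = n)
    (g : Polynomial A)
    (hg : M 0 i * M 1 j * M 2 l - M 0 i * M 1 l * M 2 j
      - M 0 j * M 1 i * M 2 l + M 0 j * M 1 l * M 2 i
      + M 0 l * M 1 i * M 2 j - M 0 l * M 1 j * M 2 i = Polynomial.X ^ n * g)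
    (hv : g.eval 0 = v (idx i j l)) :
    ∃ g : Polynomial A, aeval (fun p : Fin 3 × Fin 6 => M p.1 p.2)
      (pluckerMap k 3 6 (X (idx i j l))) = Polynomial.X ^ (wN (idx i j l)) * g ∧
        g.coeff 0 = v (idx i j l) := by
  refine ⟨g, ?_, ?_⟩
  · rw [hn, ← hg, pl_lt k i j l hij hjl]
    simp [DD]
  · rw [Polynomial.coeff_zero_eq_eval_zero, hv]

noncomputable def vv {L A : Type} [Field A] (e : Fin 3 → Bool → Tr → ℕ) (τ : Tr → L)
    (z : ((Fin 3 × Bool) ⊕ L) → A) (T : Tr) : A :=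
  z (Sum.inr (τ T)) * ((z (Sum.inl (0, false)) ^ e 0 false T * z (Sum.inl (0, true)) ^ e 0 true T) *
   (z (Sum.inl (1, false)) ^ e 1 false T * z (Sum.inl (1, true)) ^ e 1 true T) *
   (z (Sum.inl (2, false)) ^ e 2 false T * z (Sum.inl (2, true)) ^ e 2 true T))

theorem vv_eval {L A : Type} [Field A] {e : Fin 3 → Bool → Tr → ℕ} {τ : Tr → L}
    {z : ((Fin 3 × Bool) ⊕ L) → A} {T : Tr} (o : L) (a1 a2 b1 b2 c1 c2 : ℕ) (ho : τ T = o)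
    (h : e 0 false T = a1 ∧ e 0 true T = a2 ∧ e 1 false T = b1 ∧ e 1 true T = b2 ∧
      e 2 false T = c1 ∧ e 2 true T = c2) :
    vv e τ z T = z (Sum.inr o) * ((z (Sum.inl (0, false)) ^ a1 * z (Sum.inl (0, true)) ^ a2) *
   (z (Sum.inl (1, false)) ^ b1 * z (Sum.inl (1, true)) ^ b2) *
   (z (Sum.inl (2, false)) ^ c1 * z (Sum.inl (2, true)) ^ c2)) := by
  obtain ⟨rfl, rfl, rfl, rfl, rfl, rfl⟩ := h
  subst ho
  rfl

theorem aeval_dvec {L A : Type} [Field A] [Algebra k A] (e : Fin 3 → Bool → Tr → ℕ) (τ : Tr → L)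
    (z : ((Fin 3 × Bool) ⊕ L) → A) (T : Tr) :
    aeval z (monomial (dvec e τ T) (1 : k)) = vv e τ z T := by
  rw [aeval_monomial, dvec, Finsupp.prod_add_index' (by simp) (by simp [pow_add]),
    ← Finsupp.prod_finset_sum_index (by simp) (by simp [pow_add])]
  simp [vv, Fintype.prod_prod_type, Fin.prod_univ_three]
  left
  ring

theorem solve2 {A : Type} [Field A] (m1 m2 u1 u2 v1 v2 p q : A) (h1 : m1 ≠ 0) (h2 : m2 ≠ 0)
    (hD : u2 * v1 - u1 * v2 ≠ 0) : ∃ l1 l2 : A, u1 / m1 * l2 - u2 / m1 * l1 = p ∧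
      v2 / m2 * l1 - v1 / m2 * l2 = q := by
  refine ⟨(-m1 * p * v1 - m2 * q * u1) / (u2 * v1 - u1 * v2),
    (-m1 * p * v2 - m2 * q * u2) / (u2 * v1 - u1 * v2), ?_, ?_⟩
  · rw [div_mul_div_comm, div_mul_div_comm, ← sub_div, div_eq_iff (mul_ne_zero h1 hD)]
    ring
  · rw [div_mul_div_comm, div_mul_div_comm, ← sub_div, div_eq_iff (mul_ne_zero h2 hD)]
    ring

def typP (T : Tr) : ℕ × ℕ := ((T.1 ∩ {0, 1}).card, (T.1 ∩ {2, 3}).card)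

theorem flipP : FlipData eP typP swp where
  tot_le := by decide +kernel
  tot_eq := by decide +kernel
  fl_same := by decide +kernel
  fl_other := by decide +kernel
  fl_typ := by decide +kernel
  inj := by decide +kernel

def eQ (i : Fin 3) (b : Bool) (T : Tr) : ℕ :=
  if (i = 0 ∧ (({2, 3} : Finset (Fin 6)) ⊆ T.1 ∨ ({4, 5} : Finset (Fin 6)) ⊆ T.1)) ∨
    (i = 1 ∧ (({0, 1} : Finset (Fin 6)) ⊆ T.1 ∨ ({4, 5} : Finset (Fin 6)) ⊆ T.1))
  then eP i b T else 0

def flQ (i : Fin 3) (T : Tr) : Tr := if eQ i true T + eQ i false T = 1 then swp i T else T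

def typQ (T : Tr) : Finset (Fin 6) :=
  if eQ 0 true T + eQ 0 false T = 1 then T.1 \ {0, 1}
  else if eQ 1 true T + eQ 1 false T = 1 then T.1 ∪ {2, 3} else T.1

theorem flipQ : FlipData eQ typQ flQ where
  tot_le := by decide +kernel
  tot_eq := by decide +kernel
  fl_same := by decide +kernel
  fl_other := by decide +kernel
  fl_typ := by decide +kernel
  inj := by decide +kernel


noncomputable def vQ {A : Type} [Field A] (z : ((Fin 3 × Bool) ⊕ Finset (Fin 6)) → A) (T : Tr) :
    A := if wN T = 0 then 0 else vv eQ typQ z T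

theorem vQ_pos {A : Type} [Field A] {z : ((Fin 3 × Bool) ⊕ Finset (Fin 6)) → A} {T : Tr}
    (h : wN T = 0) : vQ z T = 0 := if_pos h

theorem vQ_neg {A : Type} [Field A] {z : ((Fin 3 × Bool) ⊕ Finset (Fin 6)) → A} {T : Tr}
    (h : wN T ≠ 0) : vQ z T = vv eQ typQ z T := if_neg h

set_option linter.unusedSimpArgs false
set_option maxHeartbeats 1000000

theorem liftP {A : Type} [Field A] [Algebra k A] (z : ((Fin 3 × Bool) ⊕ (ℕ × ℕ)) → A)
    (hz : ∀ q, z q ≠ 0) (F : MvPolynomial Tr k) (hF : F ∈ JJ k) :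
    aeval (vv eP typP z) F = 0 := by
  have key : ∀ r : A, ∃ p : Polynomial A, p.eval 0 = r := fun r => ⟨Polynomial.C r, by simp⟩
  obtain ⟨x1, hx1⟩ := key (z (Sum.inl (0, false)))
  obtain ⟨x2, hx2⟩ := key (z (Sum.inl (0, true)))
  obtain ⟨y1, hy1⟩ := key (z (Sum.inl (1, false)))
  obtain ⟨y2, hy2⟩ := key (z (Sum.inl (1, true)))
  obtain ⟨w1, hw1⟩ := key (z (Sum.inr (1, 1)) * z (Sum.inl (2, false)))
  obtain ⟨w2, hw2⟩ := key (z (Sum.inr (1, 1)) * z (Sum.inl (2, true)))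
  obtain ⟨a, ha⟩ := key (z (Sum.inr (2, 0)) / (z (Sum.inl (0, false)) * z (Sum.inr (1, 1))))
  obtain ⟨b, hb⟩ := key (-z (Sum.inr (2, 1)) / z (Sum.inl (0, false)))
  obtain ⟨c, hc⟩ := key (-z (Sum.inr (0, 2)) / (z (Sum.inl (1, false)) * z (Sum.inr (1, 1))))
  obtain ⟨d, hd⟩ := key (z (Sum.inr (1, 2)) / z (Sum.inl (1, false)))
  obtain ⟨e, he⟩ := key (z (Sum.inr (0, 1)) / (z (Sum.inr (1, 1)) * z (Sum.inl (2, false))))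
  obtain ⟨f, hf⟩ := key (-z (Sum.inr (1, 0)) / (z (Sum.inr (1, 1)) * z (Sum.inl (2, false))))
  have n1 := hz (Sum.inl (0, false))
  have n2 := hz (Sum.inl (1, false))
  have n3 := hz (Sum.inl (2, false))
  have n4 := hz (Sum.inr (1, 1))
  clear key
  refine lift_main k ![![x1, x2, 0, Polynomial.X ^ 2 * c, 0, Polynomial.X ^ 2 * e],
    ![0, Polynomial.X ^ 2 * a, y1, y2, 0, Polynomial.X ^ 2 * f],
    ![0, Polynomial.X * b, 0, Polynomial.X * d, w1, w2]] _ (fun T => ?_) F hF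
  clear hF
  rcases tr_cases T with rfl | rfl | rfl | rfl | rfl | rfl | rfl | rfl | rfl | rfl | rfl | rfl |
    rfl | rfl | rfl | rfl | rfl | rfl | rfl | rfl
  · exact lift_T k 0 1 2 (by decide) (by decide) 1 (by decide)
      (-(b * x1 * y1))
      (by simp <;> ring) (by rw [vv_eval (2, 1) 0 0 1 0 0 0 (by decide) (by decide)]; simp [hx1, hx2, hy1, hy2, hw1, hw2, ha, hb, hc, hd, he, hf] <;> field_simp <;> simp)
  · exact lift_T k 0 1 3 (by decide) (by decide) 1 (by decide)
      (-(b * x1 * y2) + a * d * x1 * Polynomial.X ^ 2)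
      (by simp <;> ring) (by rw [vv_eval (2, 1) 0 0 0 1 0 0 (by decide) (by decide)]; simp [hx1, hx2, hy1, hy2, hw1, hw2, ha, hb, hc, hd, he, hf] <;> field_simp <;> simp)
  · exact lift_T k 0 1 4 (by decide) (by decide) 2 (by decide)
      (a * w1 * x1)
      (by simp <;> ring) (by rw [vv_eval (2, 0) 0 0 0 0 1 0 (by decide) (by decide)]; simp [hx1, hx2, hy1, hy2, hw1, hw2, ha, hb, hc, hd, he, hf] <;> field_simp <;> simp)
  · exact lift_T k 0 1 5 (by decide) (by decide) 2 (by decide)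
      (a * w2 * x1 - b * f * x1 * Polynomial.X ^ 1)
      (by simp <;> ring) (by rw [vv_eval (2, 0) 0 0 0 0 0 1 (by decide) (by decide)]; simp [hx1, hx2, hy1, hy2, hw1, hw2, ha, hb, hc, hd, he, hf] <;> field_simp <;> simp)
  · exact lift_T k 0 2 3 (by decide) (by decide) 1 (by decide)
      (d * x1 * y1)
      (by simp <;> ring) (by rw [vv_eval (1, 2) 1 0 0 0 0 0 (by decide) (by decide)]; simp [hx1, hx2, hy1, hy2, hw1, hw2, ha, hb, hc, hd, he, hf] <;> field_simp <;> simp)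
  · exact lift_T k 0 2 4 (by decide) (by decide) 0 (by decide)
      (w1 * x1 * y1)
      (by simp <;> ring) (by rw [vv_eval (1, 1) 1 0 1 0 1 0 (by decide) (by decide)]; simp [hx1, hx2, hy1, hy2, hw1, hw2, ha, hb, hc, hd, he, hf] <;> field_simp <;> simp)
  · exact lift_T k 0 2 5 (by decide) (by decide) 0 (by decide)
      (w2 * x1 * y1)
      (by simp <;> ring) (by rw [vv_eval (1, 1) 1 0 1 0 0 1 (by decide) (by decide)]; simp [hx1, hx2, hy1, hy2, hw1, hw2, ha, hb, hc, hd, he, hf] <;> field_simp <;> simp)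
  · exact lift_T k 0 3 4 (by decide) (by decide) 0 (by decide)
      (w1 * x1 * y2)
      (by simp <;> ring) (by rw [vv_eval (1, 1) 1 0 0 1 1 0 (by decide) (by decide)]; simp [hx1, hx2, hy1, hy2, hw1, hw2, ha, hb, hc, hd, he, hf] <;> field_simp <;> simp)
  · exact lift_T k 0 3 5 (by decide) (by decide) 0 (by decide)
      (w2 * x1 * y2 - d * f * x1 * Polynomial.X ^ 3)
      (by simp <;> ring) (by rw [vv_eval (1, 1) 1 0 0 1 0 1 (by decide) (by decide)]; simp [hx1, hx2, hy1, hy2, hw1, hw2, ha, hb, hc, hd, he, hf] <;> field_simp <;> simp)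
  · exact lift_T k 0 4 5 (by decide) (by decide) 2 (by decide)
      (-(f * w1 * x1))
      (by simp <;> ring) (by rw [vv_eval (1, 0) 1 0 0 0 0 0 (by decide) (by decide)]; simp [hx1, hx2, hy1, hy2, hw1, hw2, ha, hb, hc, hd, he, hf] <;> field_simp <;> simp)
  · exact lift_T k 1 2 3 (by decide) (by decide) 1 (by decide)
      (d * x2 * y1 - b * c * y1 * Polynomial.X ^ 2)
      (by simp <;> ring) (by rw [vv_eval (1, 2) 0 1 0 0 0 0 (by decide) (by decide)]; simp [hx1, hx2, hy1, hy2, hw1, hw2, ha, hb, hc, hd, he, hf] <;> field_simp <;> simp)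
  · exact lift_T k 1 2 4 (by decide) (by decide) 0 (by decide)
      (w1 * x2 * y1)
      (by simp <;> ring) (by rw [vv_eval (1, 1) 0 1 1 0 1 0 (by decide) (by decide)]; simp [hx1, hx2, hy1, hy2, hw1, hw2, ha, hb, hc, hd, he, hf] <;> field_simp <;> simp)
  · exact lift_T k 1 2 5 (by decide) (by decide) 0 (by decide)
      (w2 * x2 * y1 - b * e * y1 * Polynomial.X ^ 3)
      (by simp <;> ring) (by rw [vv_eval (1, 1) 0 1 1 0 0 1 (by decide) (by decide)]; simp [hx1, hx2, hy1, hy2, hw1, hw2, ha, hb, hc, hd, he, hf] <;> field_simp <;> simp)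
  · exact lift_T k 1 3 4 (by decide) (by decide) 0 (by decide)
      (w1 * x2 * y2 - a * c * w1 * Polynomial.X ^ 4)
      (by simp <;> ring) (by rw [vv_eval (1, 1) 0 1 0 1 1 0 (by decide) (by decide)]; simp [hx1, hx2, hy1, hy2, hw1, hw2, ha, hb, hc, hd, he, hf] <;> field_simp <;> simp)
  · exact lift_T k 1 3 5 (by decide) (by decide) 0 (by decide)
      (w2 * x2 * y2 - b * e * y2 * Polynomial.X ^ 3 - d * f * x2 * Polynomial.X ^ 3 - a * c * w2 * Polynomial.X ^ 4 + a * d * e * Polynomial.X ^ 5 + b * c * f * Polynomial.X ^ 5)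
      (by simp <;> ring) (by rw [vv_eval (1, 1) 0 1 0 1 0 1 (by decide) (by decide)]; simp [hx1, hx2, hy1, hy2, hw1, hw2, ha, hb, hc, hd, he, hf] <;> field_simp <;> simp)
  · exact lift_T k 1 4 5 (by decide) (by decide) 2 (by decide)
      (-(f * w1 * x2) + a * e * w1 * Polynomial.X ^ 2)
      (by simp <;> ring) (by rw [vv_eval (1, 0) 0 1 0 0 0 0 (by decide) (by decide)]; simp [hx1, hx2, hy1, hy2, hw1, hw2, ha, hb, hc, hd, he, hf] <;> field_simp <;> simp)
  · exact lift_T k 2 3 4 (by decide) (by decide) 2 (by decide)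
      (-(c * w1 * y1))
      (by simp <;> ring) (by rw [vv_eval (0, 2) 0 0 0 0 1 0 (by decide) (by decide)]; simp [hx1, hx2, hy1, hy2, hw1, hw2, ha, hb, hc, hd, he, hf] <;> field_simp <;> simp)
  · exact lift_T k 2 3 5 (by decide) (by decide) 2 (by decide)
      (-(c * w2 * y1) + d * e * y1 * Polynomial.X ^ 1)
      (by simp <;> ring) (by rw [vv_eval (0, 2) 0 0 0 0 0 1 (by decide) (by decide)]; simp [hx1, hx2, hy1, hy2, hw1, hw2, ha, hb, hc, hd, he, hf] <;> field_simp <;> simp)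
  · exact lift_T k 2 4 5 (by decide) (by decide) 2 (by decide)
      (e * w1 * y1)
      (by simp <;> ring) (by rw [vv_eval (0, 1) 0 0 1 0 0 0 (by decide) (by decide)]; simp [hx1, hx2, hy1, hy2, hw1, hw2, ha, hb, hc, hd, he, hf] <;> field_simp <;> simp)
  · exact lift_T k 3 4 5 (by decide) (by decide) 2 (by decide)
      (e * w1 * y2 - c * f * w1 * Polynomial.X ^ 2)
      (by simp <;> ring) (by rw [vv_eval (0, 1) 0 0 0 1 0 0 (by decide) (by decide)]; simp [hx1, hx2, hy1, hy2, hw1, hw2, ha, hb, hc, hd, he, hf] <;> field_simp <;> simp)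

theorem liftQ {A : Type} [Field A] [Algebra k A] (z : ((Fin 3 × Bool) ⊕ Finset (Fin 6)) → A)
    (hz : ∀ q, z q ≠ 0) (hD : z (Sum.inr {0, 1, 5}) * z (Sum.inr {2, 3, 4}) -
      z (Sum.inr {0, 1, 4}) * z (Sum.inr {2, 3, 5}) ≠ 0)
    (F : MvPolynomial Tr k) (hF : F ∈ JJ k) :
    aeval (vQ z) F = 0 := by
  have key : ∀ r : A, ∃ p : Polynomial A, p.eval 0 = r := fun r => ⟨Polynomial.C r, by simp⟩
  have hsol : ∃ l1 l2 : A,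
      z (Sum.inr {0, 1, 4}) / z (Sum.inr {0, 1, 2, 3}) * l2 -
        z (Sum.inr {0, 1, 5}) / z (Sum.inr {0, 1, 2, 3}) * l1 = z (Sum.inr {4, 5}) ∧
      z (Sum.inr {2, 3, 5}) / z (Sum.inr {2, 3}) * l1 -
        z (Sum.inr {2, 3, 4}) / z (Sum.inr {2, 3}) * l2 = z (Sum.inr {2, 3, 4, 5}) := by
    exact solve2 _ _ _ _ _ _ _ _ (hz _) (hz _) hD
  obtain ⟨r1, r2, hr1, hr2⟩ := hsol
  obtain ⟨x1, hx1⟩ := key (z (Sum.inl (0, false)))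
  obtain ⟨x2, hx2⟩ := key (z (Sum.inl (0, true)))
  obtain ⟨y1, hy1⟩ := key (z (Sum.inl (1, false)))
  obtain ⟨y2, hy2⟩ := key (z (Sum.inl (1, true)))
  obtain ⟨a, ha⟩ := key (-z (Sum.inr {0, 1, 2, 3}) / z (Sum.inl (0, false)))
  obtain ⟨b, hb⟩ := key (z (Sum.inr {2, 3}) / z (Sum.inl (1, false)))
  obtain ⟨h1, hh1⟩ := key (z (Sum.inr {0, 1, 4}) / z (Sum.inr {0, 1, 2, 3}))
  obtain ⟨h2, hh2⟩ := key (z (Sum.inr {0, 1, 5}) / z (Sum.inr {0, 1, 2, 3}))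
  obtain ⟨g1, hg1⟩ := key (z (Sum.inr {2, 3, 4}) / z (Sum.inr {2, 3}))
  obtain ⟨g2, hg2⟩ := key (z (Sum.inr {2, 3, 5}) / z (Sum.inr {2, 3}))
  obtain ⟨l1, hl1⟩ := key r1
  obtain ⟨l2, hl2⟩ := key r2
  have n1 := hz (Sum.inl (0, false))
  have n2 := hz (Sum.inl (1, false))
  have n3 := hz (Sum.inr {0, 1, 2, 3})
  have n4 := hz (Sum.inr {2, 3})
  clear key
  refine lift_main k ![![x1, x2, 0, 0, Polynomial.X * g1, Polynomial.X * g2],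
    ![0, 0, y1, y2, Polynomial.X * h1, Polynomial.X * h2],
    ![0, Polynomial.X * a, 0, Polynomial.X * b, Polynomial.X * l1, Polynomial.X * l2]] _
    (fun T => ?_) F hF
  clear hF
  rcases tr_cases T with rfl | rfl | rfl | rfl | rfl | rfl | rfl | rfl | rfl | rfl | rfl | rfl |
    rfl | rfl | rfl | rfl | rfl | rfl | rfl | rfl
  · exact lift_T k 0 1 2 (by decide) (by decide) 1 (by decide)
      (-(a * x1 * y1))
      (by simp <;> ring) (by rw [vQ_neg (by decide)]; rw [vv_eval {0, 1, 2, 3} 0 0 1 0 0 0 (by decide) (by decide)]; simp [hx1, hx2, hy1, hy2, ha, hb, hh1, hh2, hg1, hg2, hl1, hl2] <;> field_simp <;> simp)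
  · exact lift_T k 0 1 3 (by decide) (by decide) 1 (by decide)
      (-(a * x1 * y2))
      (by simp <;> ring) (by rw [vQ_neg (by decide)]; rw [vv_eval {0, 1, 2, 3} 0 0 0 1 0 0 (by decide) (by decide)]; simp [hx1, hx2, hy1, hy2, ha, hb, hh1, hh2, hg1, hg2, hl1, hl2] <;> field_simp <;> simp)
  · exact lift_T k 0 1 4 (by decide) (by decide) 2 (by decide)
      (-(a * h1 * x1))
      (by simp <;> ring) (by rw [vQ_neg (by decide)]; rw [vv_eval {0, 1, 4} 0 0 0 0 0 0 (by decide) (by decide)]; simp [hx1, hx2, hy1, hy2, ha, hb, hh1, hh2, hg1, hg2, hl1, hl2] <;> field_simp <;> simp)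
  · exact lift_T k 0 1 5 (by decide) (by decide) 2 (by decide)
      (-(a * h2 * x1))
      (by simp <;> ring) (by rw [vQ_neg (by decide)]; rw [vv_eval {0, 1, 5} 0 0 0 0 0 0 (by decide) (by decide)]; simp [hx1, hx2, hy1, hy2, ha, hb, hh1, hh2, hg1, hg2, hl1, hl2] <;> field_simp <;> simp)
  · exact lift_T k 0 2 3 (by decide) (by decide) 1 (by decide)
      (b * x1 * y1)
      (by simp <;> ring) (by rw [vQ_neg (by decide)]; rw [vv_eval {2, 3} 1 0 0 0 0 0 (by decide) (by decide)]; simp [hx1, hx2, hy1, hy2, ha, hb, hh1, hh2, hg1, hg2, hl1, hl2] <;> field_simp <;> simp)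
  · exact lift_T k 0 2 4 (by decide) (by decide) 0 (by decide)
      (l1 * x1 * y1 * Polynomial.X ^ 1)
      (by simp <;> ring) (by rw [vQ_pos (by decide)]; simp)
  · exact lift_T k 0 2 5 (by decide) (by decide) 0 (by decide)
      (l2 * x1 * y1 * Polynomial.X ^ 1)
      (by simp <;> ring) (by rw [vQ_pos (by decide)]; simp)
  · exact lift_T k 0 3 4 (by decide) (by decide) 0 (by decide)
      (l1 * x1 * y2 * Polynomial.X ^ 1 - b * h1 * x1 * Polynomial.X ^ 2)
      (by simp <;> ring) (by rw [vQ_pos (by decide)]; simp)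
  · exact lift_T k 0 3 5 (by decide) (by decide) 0 (by decide)
      (l2 * x1 * y2 * Polynomial.X ^ 1 - b * h2 * x1 * Polynomial.X ^ 2)
      (by simp <;> ring) (by rw [vQ_pos (by decide)]; simp)
  · exact lift_T k 0 4 5 (by decide) (by decide) 2 (by decide)
      (h1 * l2 * x1 - h2 * l1 * x1)
      (by simp <;> ring) (by rw [vQ_neg (by decide)]; rw [vv_eval {4, 5} 1 0 0 0 0 0 (by decide) (by decide)]; rw [← hr1]; simp [hx1, hx2, hy1, hy2, ha, hb, hh1, hh2, hg1, hg2, hl1, hl2]; ring)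
  · exact lift_T k 1 2 3 (by decide) (by decide) 1 (by decide)
      (b * x2 * y1)
      (by simp <;> ring) (by rw [vQ_neg (by decide)]; rw [vv_eval {2, 3} 0 1 0 0 0 0 (by decide) (by decide)]; simp [hx1, hx2, hy1, hy2, ha, hb, hh1, hh2, hg1, hg2, hl1, hl2] <;> field_simp <;> simp)
  · exact lift_T k 1 2 4 (by decide) (by decide) 0 (by decide)
      (l1 * x2 * y1 * Polynomial.X ^ 1 - a * g1 * y1 * Polynomial.X ^ 2)
      (by simp <;> ring) (by rw [vQ_pos (by decide)]; simp)
  · exact lift_T k 1 2 5 (by decide) (by decide) 0 (by decide)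
      (l2 * x2 * y1 * Polynomial.X ^ 1 - a * g2 * y1 * Polynomial.X ^ 2)
      (by simp <;> ring) (by rw [vQ_pos (by decide)]; simp)
  · exact lift_T k 1 3 4 (by decide) (by decide) 0 (by decide)
      (l1 * x2 * y2 * Polynomial.X ^ 1 - a * g1 * y2 * Polynomial.X ^ 2 - b * h1 * x2 * Polynomial.X ^ 2)
      (by simp <;> ring) (by rw [vQ_pos (by decide)]; simp)
  · exact lift_T k 1 3 5 (by decide) (by decide) 0 (by decide)
      (l2 * x2 * y2 * Polynomial.X ^ 1 - a * g2 * y2 * Polynomial.X ^ 2 - b * h2 * x2 * Polynomial.X ^ 2)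
      (by simp <;> ring) (by rw [vQ_pos (by decide)]; simp)
  · exact lift_T k 1 4 5 (by decide) (by decide) 2 (by decide)
      (h1 * l2 * x2 - h2 * l1 * x2 + a * g1 * h2 * Polynomial.X ^ 1 - a * g2 * h1 * Polynomial.X ^ 1)
      (by simp <;> ring) (by rw [vQ_neg (by decide)]; rw [vv_eval {4, 5} 0 1 0 0 0 0 (by decide) (by decide)]; rw [← hr1]; simp [hx1, hx2, hy1, hy2, ha, hb, hh1, hh2, hg1, hg2, hl1, hl2]; ring)
  · exact lift_T k 2 3 4 (by decide) (by decide) 2 (by decide)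
      (b * g1 * y1)
      (by simp <;> ring) (by rw [vQ_neg (by decide)]; rw [vv_eval {2, 3, 4} 0 0 0 0 0 0 (by decide) (by decide)]; simp [hx1, hx2, hy1, hy2, ha, hb, hh1, hh2, hg1, hg2, hl1, hl2] <;> field_simp <;> simp)
  · exact lift_T k 2 3 5 (by decide) (by decide) 2 (by decide)
      (b * g2 * y1)
      (by simp <;> ring) (by rw [vQ_neg (by decide)]; rw [vv_eval {2, 3, 5} 0 0 0 0 0 0 (by decide) (by decide)]; simp [hx1, hx2, hy1, hy2, ha, hb, hh1, hh2, hg1, hg2, hl1, hl2] <;> field_simp <;> simp)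
  · exact lift_T k 2 4 5 (by decide) (by decide) 2 (by decide)
      (-(g1 * l2 * y1) + g2 * l1 * y1)
      (by simp <;> ring) (by rw [vQ_neg (by decide)]; rw [vv_eval {2, 3, 4, 5} 0 0 1 0 0 0 (by decide) (by decide)]; rw [← hr2]; simp [hx1, hx2, hy1, hy2, ha, hb, hh1, hh2, hg1, hg2, hl1, hl2]; ring)
  · exact lift_T k 3 4 5 (by decide) (by decide) 2 (by decide)
      (-(g1 * l2 * y2) + g2 * l1 * y2 + b * g1 * h2 * Polynomial.X ^ 1 - b * g2 * h1 * Polynomial.X ^ 1)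
      (by simp <;> ring) (by rw [vQ_neg (by decide)]; rw [vv_eval {2, 3, 4, 5} 0 0 0 1 0 0 (by decide) (by decide)]; rw [← hr2]; simp [hx1, hx2, hy1, hy2, ha, hb, hh1, hh2, hg1, hg2, hl1, hl2]; ring)

end Lift

section Final

variable (k : Type) [Field k]

theorem rel_ex (i : Fin 3) (T T' : Tr) (h : eP i false T = 1) (h' : eP i true T' = 1) :
    ∃ b c e f : Fin 6, okOut i b c = true ∧ okOut i e f = true ∧
      (X T * X T' - X (swp i T) * X (swp i T') : MvPolynomial Tr k) =
      X (idx (pt i false) b c) * X (idx (pt i true) e f) -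
        X (idx (pt i true) b c) * X (idx (pt i false) e f) := by
  obtain ⟨b, c, h1, h2, h3⟩ := eP_ex i false T h
  obtain ⟨e, f, h4, h5, h6⟩ := eP_ex i true T' h'
  refine ⟨b, c, e, f, h1, h4, ?_⟩
  rw [h3, h6, h2, h5]
  rfl

theorem okE_cases : ∀ (i : Fin 3) (b c e f : Fin 6), okOut i b c = true → okOut i e f = true →
    (okE i b c e f = true ∨ (i = 2 ∧ b = 0 ∧ c = 1 ∧ e = 2 ∧ f = 3) ∨
      (i = 2 ∧ b = 2 ∧ c = 3 ∧ e = 0 ∧ f = 1)) := by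
  decide +kernel

noncomputable def bb : MvPolynomial Tr k :=
  X (idx 4 0 1) * X (idx 5 2 3) - X (idx 5 0 1) * X (idx 4 2 3)

theorem P_eq : Pideal k = JJ k ⊔ Ideal.span {bb k} := by
  have h1 : tri 0 1 4 (by decide) = idx 4 0 1 := by decide
  have h2 : tri 2 3 5 (by decide) = idx 5 2 3 := by decide
  have h3 : tri 0 1 5 (by decide) = idx 5 0 1 := by decide
  have h4 : tri 2 3 4 (by decide) = idx 4 2 3 := by decide
  rw [Pideal, h1, h2, h3, h4]
  rfl

theorem Q_le (I : Ideal (MvPolynomial Tr k)) (h1 : JJ k ≤ I) (h : ∀ T, wN T = 0 → X T ∈ I) :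
    Qideal k ≤ I := by
  refine sup_le h1 (Ideal.span_le.2 ?_)
  intro f hf
  simp only [Set.mem_insert_iff, Set.mem_singleton_iff] at hf
  rcases hf with rfl | rfl | rfl | rfl | rfl | rfl | rfl | rfl <;> exact h _ (by decide)

theorem wN_zero : ∀ T : Tr, wN T = 0 → T = tri 0 2 4 (by decide) ∨ T = tri 0 2 5 (by decide) ∨
    T = tri 0 3 4 (by decide) ∨ T = tri 0 3 5 (by decide) ∨ T = tri 1 2 4 (by decide) ∨
    T = tri 1 2 5 (by decide) ∨ T = tri 1 3 4 (by decide) ∨ T = tri 1 3 5 (by decide) := by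
  decide +kernel

theorem X_mem_Q (T : Tr) (h : wN T = 0) : (X T : MvPolynomial Tr k) ∈ Qideal k := by
  refine Ideal.mem_sup_right (Ideal.subset_span ?_)
  simp only [Set.mem_insert_iff, Set.mem_singleton_iff]
  rcases wN_zero T h with rfl | rfl | rfl | rfl | rfl | rfl | rfl | rfl <;> simp

theorem J_le_Q : JJ k ≤ Qideal k := le_sup_left

theorem kerP_le (f : MvPolynomial Tr k) (hf : toricMap k eP typP f = 0) : f ∈ Pideal k := by
  refine flipP.ker_le _ (fun i T T' h h' => ?_) f hf
  obtain ⟨b, c, e, f, h1, h2, h3⟩ := rel_ex k i T T' h h'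
  rw [h3, P_eq]
  rcases okE_cases i b c e f h1 h2 with h | ⟨rfl, rfl, rfl, rfl, rfl⟩ | ⟨rfl, rfl, rfl, rfl, rfl⟩
  · exact Ideal.mem_sup_left (jrel k i b c e f h)
  · exact Ideal.mem_sup_right (Ideal.subset_span rfl)
  · have : (X (idx (pt 2 false) 2 3) * X (idx (pt 2 true) 0 1) -
        X (idx (pt 2 true) 2 3) * X (idx (pt 2 false) 0 1) : MvPolynomial Tr k) = - bb k := by
      simp only [bb, pt]
      ring
    rw [this]
    exact neg_mem (Ideal.mem_sup_right (Ideal.subset_span rfl))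

theorem aeval_toric {L A : Type} [Field A] [Algebra k A] (e : Fin 3 → Bool → Tr → ℕ) (τ : Tr → L)
    (z : ((Fin 3 × Bool) ⊕ L) → A) :
    (aeval z).comp (toricMap k e τ) = aeval (R := k) (vv e τ z) := by
  apply MvPolynomial.algHom_ext
  intro T
  simp only [AlgHom.comp_apply, toricMap, aeval_X]
  exact aeval_dvec k e τ z T

noncomputable def zz (L : Type) (q : L) : FractionRing (MvPolynomial L k) :=
  algebraMap (MvPolynomial L k) _ (X q)

theorem aeval_zz (L : Type) (f : MvPolynomial L k) :
    aeval (zz k L) f = algebraMap _ (FractionRing (MvPolynomial L k)) f := by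
  have : aeval (zz k L) = (IsScalarTower.toAlgHom k (MvPolynomial L k)
      (FractionRing (MvPolynomial L k))) := by
    apply MvPolynomial.algHom_ext
    intro q
    simp [zz]
  rw [this]
  rfl

theorem zz_inj (L : Type) (f : MvPolynomial L k) (h : aeval (zz k L) f = 0) : f = 0 := by
  rw [aeval_zz] at h
  exact (IsFractionRing.injective (MvPolynomial L k) (FractionRing (MvPolynomial L k)))
    (by rw [h, map_zero])

theorem zz_ne (L : Type) (q : L) : zz k L q ≠ 0 := by
  intro h
  have := zz_inj k L (X q) (by rw [aeval_X, h])
  exact X_ne_zero q this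

theorem J_toricP (f : MvPolynomial Tr k) (hf : f ∈ JJ k) : toricMap k eP typP f = 0 := by
  apply zz_inj
  have := liftP k (zz k _) (zz_ne k _) f hf
  rwa [← aeval_toric, AlgHom.comp_apply] at this

theorem toric_bb : toricMap k eP typP (bb k) = 0 := by
  apply zz_inj
  rw [← AlgHom.comp_apply, aeval_toric]
  simp only [bb, map_sub, map_mul, aeval_X]
  rw [vv_eval (2, 0) 0 0 0 0 1 0 (by decide) (by decide),
    vv_eval (0, 2) 0 0 0 0 0 1 (by decide) (by decide),
    vv_eval (2, 0) 0 0 0 0 0 1 (by decide) (by decide),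
    vv_eval (0, 2) 0 0 0 0 1 0 (by decide) (by decide)]
  ring

theorem P_ker : Pideal k = RingHom.ker (toricMap k eP typP) := by
  apply le_antisymm
  · rw [P_eq]
    refine sup_le (fun f hf => J_toricP k f hf) (Ideal.span_le.2 ?_)
    rintro _ rfl
    exact toric_bb k
  · intro f hf
    exact kerP_le k f hf

noncomputable def kap : MvPolynomial Tr k →ₐ[k] MvPolynomial Tr k :=
  aeval fun T => if wN T = 0 then 0 else X T

noncomputable def phQ := (toricMap k eQ typQ).comp (kap k)

theorem eQ_eP : ∀ (i : Fin 3) (t : Bool) (T : Tr), eQ i t T = 1 →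
    eP i t T = 1 ∧ i ≠ 2 ∧ flQ i T = swp i T := by
  decide +kernel

theorem kap_sub (f : MvPolynomial Tr k) : f - kap k f ∈ Qideal k := by
  rw [← Ideal.Quotient.mk_eq_mk_iff_sub_mem]
  have : (Ideal.Quotient.mkₐ k (Qideal k)).comp (kap k) = Ideal.Quotient.mkₐ k (Qideal k) := by
    apply MvPolynomial.algHom_ext
    intro T
    simp only [AlgHom.comp_apply, kap, aeval_X]
    split_ifs with h
    · rw [map_zero]
      exact (Ideal.Quotient.eq_zero_iff_mem.2 (X_mem_Q k T h)).symm
    · rfl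
  exact (DFunLike.congr_fun this f).symm

theorem kerQ_le (f : MvPolynomial Tr k) (hf : phQ k f = 0) : f ∈ Qideal k := by
  have h : kap k f ∈ Qideal k := by
    refine flipQ.ker_le _ (fun i T T' h h' => ?_) _ hf
    obtain ⟨p1, p2, p3⟩ := eQ_eP i _ T h
    obtain ⟨q1, q2, q3⟩ := eQ_eP i _ T' h'
    rw [p3, q3]
    obtain ⟨b, c, e, f, h1, h2, h3⟩ := rel_ex k i T T' p1 q1
    rw [h3]
    apply J_le_Q
    rcases okE_cases i b c e f h1 h2 with h | h | h
    · exact jrel k i b c e f h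
    · exact absurd h.1 p2
    · exact absurd h.1 p2
  have := add_mem (kap_sub k f) h
  rwa [sub_add_cancel] at this

theorem aeval_phQ {A : Type} [Field A] [Algebra k A]
    (z : ((Fin 3 × Bool) ⊕ Finset (Fin 6)) → A) :
    (aeval z).comp (phQ k) = aeval (R := k) (vQ z) := by
  rw [phQ, ← AlgHom.comp_assoc, aeval_toric]
  apply MvPolynomial.algHom_ext
  intro T
  simp only [AlgHom.comp_apply, kap, aeval_X, vQ]
  split_ifs <;> simp

theorem zzD (L : Type) (a b c d : L) (hac : a ≠ c) (had : a ≠ d) :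
    zz k L a * zz k L b - zz k L c * zz k L d ≠ 0 := by
  intro h
  have h2 := zz_inj k L (X a * X b - X c * X d) (by simpa using h)
  have h3 := congrArg (aeval (R := k) (fun q => if q = a then (0 : k) else 1)) h2
  simp [hac.symm, had.symm] at h3

theorem Q_ker : Qideal k = RingHom.ker (phQ k) := by
  apply le_antisymm
  · apply Q_le
    · intro f hf
      apply zz_inj
      have := liftQ k (zz k _) (zz_ne k _) (zzD k _ _ _ _ _ (by decide) (by decide)) f hf
      rwa [← aeval_phQ, AlgHom.comp_apply] at this
    · intro T hT
      rw [RingHom.mem_ker, phQ]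
      simp [kap, hT]
  · intro f hf
    exact kerQ_le k f hf

theorem bb_not_Q : bb k ∉ Qideal k := by
  rw [Q_ker]
  intro h
  have h : phQ k (bb k) = 0 := h
  have h2 : aeval (zz k _) (phQ k (bb k)) = 0 := by rw [h, map_zero]
  rw [← AlgHom.comp_apply, aeval_phQ] at h2
  simp only [bb, map_sub, map_mul, aeval_X] at h2
  rw [vQ_neg (by decide), vQ_neg (by decide), vQ_neg (by decide), vQ_neg (by decide),
    vv_eval {0, 1, 4} 0 0 0 0 0 0 (by decide) (by decide),
    vv_eval {2, 3, 5} 0 0 0 0 0 0 (by decide) (by decide),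
    vv_eval {0, 1, 5} 0 0 0 0 0 0 (by decide) (by decide),
    vv_eval {2, 3, 4} 0 0 0 0 0 0 (by decide) (by decide)] at h2
  simp only [pow_zero, mul_one] at h2
  exact zzD k _ _ _ _ _ (by decide) (by decide) h2

theorem X_not_P (T : Tr) : (X T : MvPolynomial Tr k) ∉ Pideal k := by
  rw [P_ker]
  intro h
  have h : toricMap k eP typP (X T) = 0 := h
  rw [toricMap, aeval_X, monomial_eq_zero] at h
  exact one_ne_zero h

theorem wz_ex : ∀ T : Tr, wN T = 0 → ∃ (t : Bool) (b c : Fin 6), okE 2 0 1 b c = true ∧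
    okE 2 b c 2 3 = true ∧ T = idx (pt 2 t) b c := by
  decide +kernel

theorem bb_mul (T : Tr) (h : wN T = 0) : bb k * X T ∈ JJ k := by
  obtain ⟨t, b, c, h1, h2, rfl⟩ := wz_ex T h
  have r1 := jrel k 2 0 1 b c h1
  have r2 := jrel k 2 b c 2 3 h2
  simp only [pt] at r1 r2
  cases t
  · have := add_mem (Ideal.mul_mem_left _ (X (idx 4 0 1)) r2) (Ideal.mul_mem_left _ (X (idx 4 2 3)) r1)
    convert this using 1
    simp only [bb, pt]
    ring
  · have := add_mem (Ideal.mul_mem_left _ (X (idx 5 0 1)) r2) (Ideal.mul_mem_left _ (X (idx 5 2 3)) r1)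
    convert this using 1
    simp only [bb, pt]
    ring

theorem bb_Q (g : MvPolynomial Tr k) (hg : g ∈ Qideal k) : bb k * g ∈ JJ k := by
  have : Qideal k ≤ (JJ k).colon (Ideal.span {bb k} : Set (MvPolynomial Tr k)) := by
    apply Q_le
    · intro f hf
      rw [Submodule.mem_colon]
      intro p _
      exact Ideal.mul_mem_right _ _ hf
    · intro T hT
      rw [Submodule.mem_colon]
      intro p hp
      obtain ⟨q, rfl⟩ := Ideal.mem_span_singleton.1 hp
      have := Ideal.mul_mem_right q _ (bb_mul k T hT)
      convert this using 1
      rw [smul_eq_mul]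
      ring
  have h := Submodule.mem_colon.1 (this hg) (bb k) (Ideal.subset_span rfl)
  rwa [smul_eq_mul, mul_comm] at h

end Final

/-- for the weight vector `w36` in the relative interior of an FFGG cone, the
initial ideal `in_w(I_{3,6})` of the Plücker ideal is not prime: it is the intersection of
the two distinct prime ideals `P` and `Q`. -/
theorem initIdeal_pluckerIdeal_three_six_not_prime (k : Type) [Field k] :
    ¬ (initIdeal w36 (pluckerIdeal k 3 6)).IsPrime
    ∧ (Pideal k).IsPrime ∧ (Qideal k).IsPrime ∧ Pideal k ≠ Qideal k
    ∧ initIdeal w36 (pluckerIdeal k 3 6) = Pideal k ⊓ Qideal k := by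
  have hQ : (Qideal k).IsPrime := by
    rw [Q_ker]
    exact RingHom.ker_isPrime _
  have hw : wN (idx 0 2 4) = 0 := by decide
  have hJP : JJ k ≤ Pideal k := le_sup_left
  refine ⟨fun h => ?_, ?_, hQ, fun h => ?_, ?_⟩
  · rcases h.mem_or_mem (bb_mul k _ hw) with h | h
    · exact bb_not_Q k (J_le_Q k h)
    · exact X_not_P k _ (hJP h)
  · rw [P_ker]
    exact RingHom.ker_isPrime _
  · exact X_not_P k _ (h ▸ X_mem_Q k _ hw)
  · refine le_antisymm (le_inf hJP (J_le_Q k)) ?_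
    rintro f ⟨h1, h2⟩
    have h1 : f ∈ Pideal k := h1
    have h2 : f ∈ Qideal k := h2
    rw [P_eq] at h1
    obtain ⟨j, hj, g, hg, rfl⟩ := Submodule.mem_sup.1 h1
    obtain ⟨g, rfl⟩ := Ideal.mem_span_singleton.1 hg
    have h3 : bb k * g ∈ Qideal k := by
      have := sub_mem h2 (J_le_Q k hj)
      rwa [add_sub_cancel_left] at this
    have h4 := (hQ.mem_or_mem h3).resolve_left (bb_not_Q k)
    exact add_mem hj (bb_Q k g h4)
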